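/- Let Φ : ℝ≥0 → Matrix(d,d,ℝ) with Φ_q = [c_{αβ}/(a_{αβ} - q)]_{αβ} defined for 0 ≤ q < min_{αβ} a_{αβ}, where all c_{αβ} > 0 and a_{αβ} > 0. If the spectral radius ρ(Φ_0) < 1, then there exists q ∈ (0, min a_{αβ}) with ρ(Φ_q) = 1. -/

import Mathlib

attribute [local instance] Matrix.linftyOpNormedRing Matrix.linftyOpNormedAlgebra

open Matrix

lemma mem_spectrum_of_mulVec {ι : Type*} [Fintype ι] [DecidableEq ι] (A : Matrix ι ι ℝ) (r : ℝ) :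
    r ∈ spectrum ℝ A ↔ ∃ x : ι → ℝ, x ≠ 0 ∧ A *ᵥ x = r • x := by
  rw [spectrum.mem_iff, Matrix.isUnit_iff_isUnit_det, isUnit_iff_ne_zero, not_not,
    ← Matrix.exists_mulVec_eq_zero_iff]
  refine exists_congr fun x => and_congr_right fun _ => ?_
  rw [Matrix.sub_mulVec, sub_eq_zero, Matrix.algebraMap_eq_diagonal]
  have : (Matrix.diagonal (algebraMap ℝ (ι → ℝ) r)) *ᵥ x = r • x := by
    ext i
    simp [Matrix.mulVec_diagonal]
  rw [this, eq_comm]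

lemma abs_le_one_of_pos_fixed {ι : Type*} [Fintype ι] [Nonempty ι] (A : Matrix ι ι ℝ)
    (hA : ∀ i j, 0 < A i j) (x : ι → ℝ) (hx : ∀ i, 0 < x i) (hfix : A *ᵥ x = x)
    (r : ℝ) (y : ι → ℝ) (hy : y ≠ 0) (hry : A *ᵥ y = r • y) : |r| ≤ 1 := by
  obtain ⟨k, hk⟩ := Finite.exists_max (fun i => |y i| / x i)
  set t := |y k| / x k with ht
  have hb : ∀ i, |y i| ≤ t * x i := fun i => (div_le_iff₀ (hx i)).1 (hk i)
  have htpos : 0 < t := by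
    obtain ⟨i, hi⟩ := Function.ne_iff.1 hy
    have : 0 < |y i| := abs_pos.2 hi
    by_contra h
    nlinarith [hb i, hx i]
  have hyk : |y k| = t * x k := by rw [ht, div_mul_cancel₀ _ (hx k).ne']
  have h1 : |r| * |y k| ≤ t * x k := by
    calc |r| * |y k| = |(A *ᵥ y) k| := by rw [hry]; simp [abs_mul]
      _ = |∑ j, A k j * y j| := rfl
      _ ≤ ∑ j, |A k j * y j| := Finset.abs_sum_le_sum_abs _ _
      _ ≤ ∑ j, t * (A k j * x j) := by
          refine Finset.sum_le_sum fun j _ => ?_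
          rw [abs_mul, abs_of_pos (hA k j)]
          nlinarith [hb j, hA k j]
      _ = t * (A *ᵥ x) k := by rw [← Finset.mul_sum]; rfl
      _ = t * x k := by rw [hfix]
  rw [hyk] at h1
  have := mul_pos htpos (hx k)
  by_contra h
  nlinarith

lemma mulVec_pos_of {ι : Type*} [Fintype ι] (A : Matrix ι ι ℝ)
    (hA : ∀ i j, 0 < A i j) (x : ι → ℝ) (hx : ∀ i, 0 ≤ x i) (hne : x ≠ 0) (i : ι) :
    0 < (A *ᵥ x) i := by
  obtain ⟨k, hk⟩ := Function.ne_iff.1 hne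
  exact Finset.sum_pos' (fun j _ => mul_nonneg (hA i j).le (hx j))
    ⟨k, Finset.mem_univ _, mul_pos (hA i k) (lt_of_le_of_ne (hx k) (Ne.symm hk))⟩

/-- normalisation to the simplex -/
lemma simplex_of {ι : Type*} [Fintype ι] (A : Matrix ι ι ℝ) (x : ι → ℝ) (hx : ∀ i, 0 ≤ x i)
    (hne : x ≠ 0) (h : ∀ i, x i ≤ (A *ᵥ x) i) :
    ∃ z ∈ stdSimplex ℝ ι, ∀ i, z i ≤ (A *ᵥ z) i := by
  obtain ⟨k, hk⟩ := Function.ne_iff.1 hne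
  have hs : 0 < ∑ i, x i := Finset.sum_pos' (fun j _ => hx j)
    ⟨k, Finset.mem_univ _, lt_of_le_of_ne (hx k) (Ne.symm hk)⟩
  refine ⟨(∑ i, x i)⁻¹ • x, ⟨fun i => ?_, ?_⟩, fun i => ?_⟩
  · exact mul_nonneg (inv_pos.2 hs).le (hx i)
  · simp only [Pi.smul_apply, smul_eq_mul]
    rw [← Finset.mul_sum, inv_mul_cancel₀ hs.ne']
  · rw [Matrix.mulVec_smul]
    exact mul_le_mul_of_nonneg_left (h i) (inv_pos.2 hs).le

lemma simplex_ne_zero {ι : Type*} [Fintype ι] (x : ι → ℝ) (hx : x ∈ stdSimplex ℝ ι) : x ≠ 0 := by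
  rintro rfl
  have := hx.2
  simp at this

lemma key_fixed {ι : Type*} [Fintype ι] [Nonempty ι] (A : ℝ → Matrix ι ι ℝ) (T : ℝ) (hT0 : 0 < T)
    (hcont : ∀ i j, Continuous fun t => A t i j)
    (hpos : ∀ t, 0 < t → t ≤ T → ∀ i j, 0 < A t i j)
    (hT : ∃ x ∈ stdSimplex ℝ ι, ∀ i, x i ≤ (A T *ᵥ x) i)
    (h0 : ¬ ∃ x ∈ stdSimplex ℝ ι, ∀ i, x i ≤ (A 0 *ᵥ x) i) :
    ∃ t, 0 < t ∧ t ≤ T ∧ ∃ x : ι → ℝ, (∀ i, 0 < x i) ∧ A t *ᵥ x = x := by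
  have hc1 : ∀ i, Continuous fun p : ℝ × (ι → ℝ) => (A p.1 *ᵥ p.2) i := by
    intro i
    change Continuous fun p : ℝ × (ι → ℝ) => ∑ j, A p.1 i j * p.2 j
    refine continuous_finsetSum _ fun j _ => ?_
    exact ((hcont i j).comp continuous_fst).mul ((continuous_apply j).comp continuous_snd)
  set K : Set (ℝ × (ι → ℝ)) :=
    (Set.Icc 0 T ×ˢ stdSimplex ℝ ι) ∩ {p | ∀ i, p.2 i ≤ (A p.1 *ᵥ p.2) i} with hK
  have hKc : IsCompact K := by
    refine (isCompact_Icc.prod (isCompact_stdSimplex ℝ ι)).inter_right ?_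
    rw [Set.ofPred_forall]
    exact isClosed_iInter fun i =>
      isClosed_le ((continuous_apply i).comp continuous_snd) (hc1 i)
  obtain ⟨x₁, hx₁, hx₁'⟩ := hT
  have hKn : K.Nonempty := ⟨(T, x₁), ⟨⟨⟨hT0.le, le_rfl⟩, hx₁⟩, hx₁'⟩⟩
  obtain ⟨⟨t, x⟩, ⟨⟨⟨ht0, htT⟩, hx⟩, hxA⟩, hmin⟩ := hKc.exists_isMinOn hKn continuous_fst.continuousOn
  simp only at ht0 htT hx
  have hxA : ∀ i, x i ≤ (A t *ᵥ x) i := hxA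
  have htpos : 0 < t := by
    rcases ht0.eq_or_lt with h | h
    · subst h; exact absurd ⟨x, hx, hxA⟩ h0
    · exact h
  have hxne := simplex_ne_zero x hx
  have hAx := mulVec_pos_of (A t) (hpos t htpos htT) x hx.1 hxne
  have heq : A t *ᵥ x = x := by
    by_contra hne
    set y := A t *ᵥ x with hy
    have hstrict : ∀ i, y i < (A t *ᵥ y) i := by
      intro i
      have := mulVec_pos_of (A t) (hpos t htpos htT) (y - x)
        (fun i => sub_nonneg.2 (hxA i)) (sub_ne_zero.2 hne) i
      rw [Matrix.mulVec_sub, ← hy] at this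
      simpa using this
    have hev : ∀ᶠ s in nhds t, ∀ i, y i < (A s *ᵥ y) i := by
      rw [Filter.eventually_all]
      intro i
      have hcs : Continuous fun s : ℝ => (A s *ᵥ y) i :=
        (hc1 i).comp (continuous_id.prodMk continuous_const)
      exact hcs.continuousAt.eventually (lt_mem_nhds (hstrict i))
    have hev2 : ∀ᶠ s in nhdsWithin t (Set.Iio t), (∀ i, y i < (A s *ᵥ y) i) ∧ 0 < s ∧ s < t := by
      filter_upwards [nhdsWithin_le_nhds hev, nhdsWithin_le_nhds (lt_mem_nhds htpos),
        self_mem_nhdsWithin] with s h1 h2 h3 using ⟨h1, h2, h3⟩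
    obtain ⟨s, hs1, hs2, hs3⟩ := hev2.exists
    obtain ⟨z, hz, hz'⟩ := simplex_of (A s) y (fun i => (hAx i).le)
      (fun h => by
        have := hAx (Classical.arbitrary ι)
        rw [h] at this
        simp at this) (fun i => (hs1 i).le)
    have := hmin (show (s, z) ∈ K from ⟨⟨⟨hs2.le, hs3.le.trans htT⟩, hz⟩, hz'⟩)
    simp at this
    linarith
  refine ⟨t, htpos, htT, x, fun i => ?_, heq⟩
  have := hAx i
  rwa [heq] at this

/-- For the exponential Hawkes kernel matrix `Φ_q = [c_{αβ}/(a_{αβ} - q)]`, with all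
`c_{αβ}, a_{αβ} > 0`, if the spectral radius of `Φ_0` is `< 1` then there exists
`q ∈ (0, min a_{αβ})` with spectral radius of `Φ_q` equal to `1`. -/
theorem exists_q_spectralRadius_eq_one
    {ι : Type*} [Fintype ι] [Nonempty ι] [DecidableEq ι]
    (c a : ι → ι → ℝ) (hc : ∀ α β, 0 < c α β) (ha : ∀ α β, 0 < a α β)
    (Φ : ℝ → Matrix ι ι ℝ) (hΦ : ∀ q, Φ q = Matrix.of fun α β => c α β / (a α β - q))
    (h0 : spectralRadius ℝ (Φ 0) < 1) :
    ∃ q : ℝ, 0 < q ∧ q < (⨅ p : ι × ι, a p.1 p.2) ∧ spectralRadius ℝ (Φ q) = 1 := by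
  have hΦ' : ∀ q i j, Φ q i j = c i j / (a i j - q) := fun q i j => by rw [hΦ]; rfl
  obtain ⟨⟨α, β⟩, hp⟩ := exists_eq_ciInf_of_finite (f := fun p : ι × ι => a p.1 p.2)
  have hle : ∀ i j, (⨅ p : ι × ι, a p.1 p.2) ≤ a i j := fun i j =>
    ciInf_le (f := fun p : ι × ι => a p.1 p.2) (Set.finite_range _).bddBelow (i, j)
  rw [← hp] at hle ⊢
  simp only at hle ⊢
  have hm := ha α β
  set m := a α β with hmdef
  -- no subinvariant vector at `0`
  have hno : ¬ ∃ x ∈ stdSimplex ℝ ι, ∀ i, x i ≤ (Φ 0 *ᵥ x) i := by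
    rintro h
    obtain ⟨t, ht0, ht1, x, hx, hfix⟩ := key_fixed (fun t => t • Φ 0) 1 one_pos
      (fun i j => by simp only [Matrix.smul_apply, smul_eq_mul]; fun_prop)
      (fun t ht _ i j => by
        have : 0 < Φ 0 i j := by rw [hΦ']; exact div_pos (hc _ _) (by simpa using ha i j)
        simpa using mul_pos ht this)
      (by simpa using h)
      (by
        rintro ⟨x, hx, hx'⟩
        refine simplex_ne_zero x hx (funext fun i => le_antisymm ?_ (hx.1 i))
        simpa using hx' i)
    have hmem : t⁻¹ ∈ spectrum ℝ (Φ 0) := by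
      rw [mem_spectrum_of_mulVec]
      refine ⟨x, fun h => ?_, ?_⟩
      · have := hx (Classical.arbitrary ι)
        rw [h] at this
        simp at this
      · simp only [Matrix.smul_mulVec] at hfix
        rw [eq_inv_smul_iff₀ ht0.ne']
        exact hfix
    have h2 : ((‖t⁻¹‖₊ : NNReal) : ENNReal) ≤ spectralRadius ℝ (Φ 0) :=
      le_iSup₂ (f := fun k (_ : k ∈ spectrum ℝ (Φ 0)) => ((‖k‖₊ : NNReal) : ENNReal)) t⁻¹ hmem
    have h3 := h2.trans_lt h0
    have h4 : ‖t⁻¹‖₊ < 1 := by exact_mod_cast h3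
    have h5 : ‖t⁻¹‖ < 1 := by exact_mod_cast h4
    rw [Real.norm_of_nonneg (inv_pos.2 ht0).le] at h5
    have := (one_le_inv₀ ht0).2 ht1
    linarith
  -- choice of the right end point
  set δ := Φ 0 β α with hδ
  have hδ0 : 0 < δ := by rw [hδ, hΦ']; exact div_pos (hc _ _) (by simpa using ha β α)
  set ε := min (m / 2) (c α β * δ / (1 + δ)) with hε
  have hε0 : 0 < ε := lt_min (by linarith) (div_pos (mul_pos (hc _ _) hδ0) (by linarith))
  have hεm : ε ≤ m / 2 := min_le_left _ _
  have hε2 : ε * (1 + δ) ≤ c α β * δ := (le_div_iff₀ (by linarith)).1 (min_le_right _ _)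
  set T := m - ε with hT
  have hT0 : 0 < T := by linarith
  have hTm : T < m := by linarith
  have hΦpos : ∀ q, q ≤ T → ∀ i j, 0 < Φ q i j := fun q hq i j => by
    rw [hΦ']; exact div_pos (hc _ _) (by linarith [hle i j])
  have hβα : δ ≤ Φ T β α := by
    rw [hδ, hΦ', hΦ']
    exact div_le_div_of_nonneg_left (hc _ _).le (by linarith [hle β α]) (by linarith)
  have hαβ : 1 + δ ≤ δ * Φ T α β := by
    have : a α β - T = ε := by rw [hT]; ring
    rw [hΦ', this, ← mul_div_assoc, le_div_iff₀ hε0]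
    linarith
  have hend : ∃ x ∈ stdSimplex ℝ ι, ∀ i, x i ≤ (Φ T *ᵥ x) i := by
    have hs : ∀ i, (0:ℝ) ≤ Pi.single (M := fun _ => ℝ) α 1 i := fun i => by
      rw [Pi.single_apply]; split_ifs <;> norm_num
    have hs2 : ∀ i, (0:ℝ) ≤ Pi.single (M := fun _ => ℝ) β δ i := fun i => by
      rw [Pi.single_apply]; split_ifs <;> linarith
    refine simplex_of (Φ T) (Pi.single α 1 + Pi.single β δ) (fun i => add_nonneg (hs i) (hs2 i))
      (fun h => ?_) (fun i => ?_)
    · have h1 := congrFun h α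
      have h2 := hs2 α
      simp only [Pi.add_apply, Pi.single_eq_same, Pi.zero_apply] at h1
      linarith
    · have h1 := hΦpos T le_rfl i α
      have h2 := mul_pos hδ0 (hΦpos T le_rfl i β)
      have e : (Φ T *ᵥ (Pi.single α 1 + Pi.single β δ)) i = Φ T i α + δ * Φ T i β := by
        rw [Matrix.mulVec_add]
        simp [Matrix.mulVec_single, mul_comm]
      rw [e, Pi.add_apply, Pi.single_apply, Pi.single_apply]
      by_cases hi : i = α
      · subst hi
        split_ifs <;> linarith
      · rw [if_neg hi]
        by_cases hi2 : i = β
        · subst hi2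
          rw [if_pos rfl]; linarith
        · rw [if_neg hi2]; linarith
  obtain ⟨q, hq0, hqT, x, hx, hfix⟩ := key_fixed (fun t => Φ (min t T)) T hT0
    (fun i j => by
      simp only [hΦ']
      refine continuous_const.div (continuous_const.sub (continuous_id.min continuous_const)) ?_
      intro t
      have : min t T ≤ T := min_le_right _ _
      have := hle i j
      exact ne_of_gt (by linarith))
    (fun t _ ht => hΦpos _ (min_le_right _ _))
    (by simpa using hend)
    (by simpa [min_eq_left hT0.le] using hno)
  simp only [min_eq_left hqT] at hfix
  refine ⟨q, hq0, lt_of_le_of_lt hqT hTm, le_antisymm ?_ ?_⟩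
  · refine iSup₂_le fun r hr => ?_
    obtain ⟨y, hy, hry⟩ := (mem_spectrum_of_mulVec _ _).1 hr
    have h1 := abs_le_one_of_pos_fixed (Φ q) (hΦpos q hqT) x hx hfix r y hy hry
    have h2 : ‖r‖₊ ≤ 1 := by
      rw [← NNReal.coe_le_coe]; simpa using h1
    exact_mod_cast h2
  · have hmem : (1 : ℝ) ∈ spectrum ℝ (Φ q) := by
      rw [mem_spectrum_of_mulVec]
      refine ⟨x, fun h => ?_, by rw [hfix, one_smul]⟩
      have := hx (Classical.arbitrary ι)
      rw [h] at this
      simp at this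
    have h2 : ((‖(1:ℝ)‖₊ : NNReal) : ENNReal) ≤ spectralRadius ℝ (Φ q) :=
      le_iSup₂ (f := fun k (_ : k ∈ spectrum ℝ (Φ q)) => ((‖k‖₊ : NNReal) : ENNReal)) 1 hmem
    simpa using h2
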